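/- arXiv:1705.01647 — 5 statements merged into one kernel-verified Lean document; each statement's English description precedes it below -/
import Mathlib

section
/- Let Γ be a group, G a finite group, ψ : Γ → G a surjective group homomorphism, P₁, P₂ ≤ G ℤ-equivalent subgroups, and set Γᵢ = ψ⁻¹(Pᵢ) for i = 1, 2. Then for every abelian group A, regarded as a ℤ[Γ]-module with trivial Γ-action, and every nonnegative integer k, the group cohomology groups Hᵏ(Γ₁, A) and Hᵏ(Γ₂, A) (with trivial coefficients) are isomorphic as abelian groups. -/
/-- Subgroups `P₁, P₂ ≤ G` are `ℤ`-equivalent if the permutation modules `ℤ[G/P₁]` and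
`ℤ[G/P₂]` are isomorphic as `ℤ[G]`-modules. -/
def Subgroup.IsZEquiv {G : Type} [Group G] (P₁ P₂ : Subgroup G) : Prop :=
  Nonempty ((Representation.ofMulAction ℤ G (G ⧸ P₁)).asModule ≃ₗ[MonoidAlgebra ℤ G]
    (Representation.ofMulAction ℤ G (G ⧸ P₂)).asModule)

universe u v

namespace Representation

open MonoidAlgebra

variable {k Γ G A : Type*} [CommRing k] [Group Γ] [Group G] [AddCommGroup A] [Module k A]

/-- A linear map `k[G/P] → A` gives, by evaluation at the cosets `ψ(γ)⁻¹P`, a function `Γ → A`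
invariant under left translation by `ψ⁻¹(P)`. -/
noncomputable def quotientHomToCoindV (ψ : Γ →* G) (P : Subgroup G) :
    (k[G ⧸ P] →ₗ[k] A) →ₗ[k] coindV (P.comap ψ).subtype (trivial k (P.comap ψ) A) where
  toFun F := ⟨fun γ => F (single (((ψ γ)⁻¹ : G) : G ⧸ P) 1), fun s γ => by
    have hs : (((ψ (s * γ))⁻¹ : G) : G ⧸ P) = ((ψ γ)⁻¹ : G) :=
      QuotientGroup.eq.2 (by
        simpa only [map_mul, inv_inv, mul_inv_cancel_right] using Subgroup.mem_comap.1 s.2)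
    exact congrArg (fun q => F (single q 1)) hs⟩
  map_add' _ _ := rfl
  map_smul' _ _ := rfl

@[simp]
lemma quotientHomToCoindV_apply (ψ : Γ →* G) (P : Subgroup G) (F : k[G ⧸ P] →ₗ[k] A) (γ : Γ) :
    (quotientHomToCoindV ψ P F).1 γ = F (single (((ψ γ)⁻¹ : G) : G ⧸ P) 1) := rfl

lemma quotientHomToCoindV_bijective (ψ : Γ →* G) (hψ : Function.Surjective ψ) (P : Subgroup G) :
    Function.Bijective (quotientHomToCoindV (k := k) (A := A) ψ P) := by
  constructor
  · intro F F' h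
    refine MonoidAlgebra.lhom_ext' fun q => LinearMap.ext_ring ?_
    obtain ⟨g, rfl⟩ := QuotientGroup.mk_surjective q
    obtain ⟨γ, hγ⟩ := hψ g⁻¹
    have hF := congrFun (congrArg Subtype.val h) γ
    simpa [hγ] using hF
  · intro f
    refine ⟨Finsupp.linearCombination k
      (fun q : G ⧸ P => f.1 (Function.surjInv hψ q.out)⁻¹) ∘ₗ
        (coeffLinearEquiv k).toLinearMap, Subtype.ext (funext fun γ => ?_)⟩
    set s := Function.surjInv hψ (((ψ γ)⁻¹ : G) : G ⧸ P).out with hs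
    have hmem : s⁻¹ * γ⁻¹ ∈ P.comap ψ := by
      have hout : ((ψ s : G) : G ⧸ P) = ((ψ γ)⁻¹ : G) := by
        rw [hs, Function.surjInv_eq hψ]
        exact QuotientGroup.out_eq' _
      simpa using QuotientGroup.eq.1 hout
    have hf := f.2 ⟨_, hmem⟩ γ
    simp only [Subgroup.subtype_apply, inv_mul_cancel_right, trivial_apply] at hf
    simpa [← hs] using hf

/-- For surjective `ψ : Γ → G`, the coinduction of the trivial representation `A` from `ψ⁻¹(P)`
to `Γ` is `Hom(k[G/P], A)`, with `Γ` acting through `ψ`. -/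
noncomputable def quotientHomEquivCoind (ψ : Γ →* G) (hψ : Function.Surjective ψ)
    (P : Subgroup G) :
    Representation.Equiv
      ((linHom (ofMulAction k G (G ⧸ P)) (trivial k G A)).comp ψ)
      (coind (P.comap ψ).subtype (trivial k (P.comap ψ) A)) :=
  .mk (.ofBijective _ (quotientHomToCoindV_bijective ψ hψ P)) fun γ => by
    ext F x
    change F (ofMulAction k G (G ⧸ P) (ψ γ)⁻¹ (single (((ψ x)⁻¹ : G) : G ⧸ P) 1)) =
      F (single (((ψ (x * γ))⁻¹ : G) : G ⧸ P) 1)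
    simp

/-- Intertwining equivalence underlying an isomorphism of `k[G]`-modules. -/
noncomputable def equivOfAsModule {V W : Type*} [AddCommGroup V] [Module k V] [AddCommGroup W]
    [Module k W] {ρ : Representation k G V} {σ : Representation k G W}
    (e : ρ.asModule ≃ₗ[k[G]] σ.asModule) : ρ.Equiv σ :=
  .mk (ρ.asModuleEquiv.symm ≪≫ₗ e.restrictScalars k ≪≫ₗ σ.asModuleEquiv) fun g => by
    ext v
    change σ.asModuleEquiv (e (ρ.asModuleEquiv.symm (ρ g v))) =
      σ g (σ.asModuleEquiv (e (ρ.asModuleEquiv.symm v)))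
    rw [asModuleEquiv_symm_map_rho, map_smul, asModuleEquiv_map_smul, asAlgebraHom_of]

/-- Precomposition with an equivalence of representations, after restriction along `ψ`. -/
noncomputable def linHomCongrLeft {V W : Type*} [AddCommGroup V] [Module k V] [AddCommGroup W]
    [Module k W] {ρ : Representation k G V} {σ : Representation k G W} (e : ρ.Equiv σ)
    (τ : Representation k G A) (ψ : Γ →* G) :
    Representation.Equiv ((linHom ρ τ).comp ψ) ((linHom σ τ).comp ψ) :=
  .mk (e.toLinearEquiv.arrowCongr (.refl k A)) fun γ => by
    ext F w
    have hw : e.symm (σ (ψ γ)⁻¹ w) = ρ (ψ γ)⁻¹ (e.symm w) :=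
      e.symm.toIntertwiningMap.isIntertwining _ _ _ _
    exact congrArg (fun v => τ (ψ γ) (F v)) hw.symm

end Representation

open CategoryTheory in
/-- If `k[G/P₁]` and `k[G/P₂]` are equivalent representations and `ψ : Γ → G` is surjective, then
`ψ⁻¹(P₁)` and `ψ⁻¹(P₂)` have isomorphic cohomology with trivial coefficients. -/
noncomputable def groupCohomology.comapTrivialIso {k Γ : Type u} {G : Type v} [CommRing k]
    [Group Γ] [Group G] (ψ : Γ →* G) (hψ : Function.Surjective ψ) {P₁ P₂ : Subgroup G}
    (e : (Representation.ofMulAction k G (G ⧸ P₁)).Equiv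
      (Representation.ofMulAction k G (G ⧸ P₂)))
    (A : Type u) [AddCommGroup A] [Module k A] (n : ℕ) :
    groupCohomology (Rep.trivial k (P₁.comap ψ) A) n ≅
      groupCohomology (Rep.trivial k (P₂.comap ψ) A) n :=
  (groupCohomology.coindIso _ n).symm ≪≫
    (groupCohomology.functor k Γ n).mapIso
      (Rep.mkIso <| (Representation.quotientHomEquivCoind ψ hψ P₁).symm.trans <|
        (Representation.linHomCongrLeft e _ ψ).trans
          (Representation.quotientHomEquivCoind ψ hψ P₂)) ≪≫
    groupCohomology.coindIso _ n

/-- Let `Γ` be a group, `G` a finite group, `ψ : Γ → G` a surjective homomorphism,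
`P₁, P₂ ≤ G` `ℤ`-equivalent subgroups and `Γᵢ = ψ⁻¹(Pᵢ)`.  Then for every abelian group `A`,
regarded as a `ℤ[Γ]`-module with trivial action, and every `k : ℕ`, the group cohomology
groups `Hᵏ(Γ₁, A)` and `Hᵏ(Γ₂, A)` (with trivial coefficients) are isomorphic as abelian
groups. -/
theorem cohomology_iso_of_isZEquiv_pullback_trivial {Γ G : Type} [Group Γ] [Group G] [Finite G]
    (ψ : Γ →* G) (hψ : Function.Surjective ψ) {P₁ P₂ : Subgroup G}
    (h : Subgroup.IsZEquiv P₁ P₂)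
    (Γ₁ Γ₂ : Subgroup Γ) (hΓ₁ : Γ₁ = P₁.comap ψ) (hΓ₂ : Γ₂ = P₂.comap ψ)
    (A : Type) [AddCommGroup A] [Module ℤ A] (k : ℕ) :
    Nonempty ((groupCohomology (Rep.trivial ℤ ↥Γ₁ A) k) ≃+
      (groupCohomology (Rep.trivial ℤ ↥Γ₂ A) k)) := by
  subst hΓ₁ hΓ₂
  obtain ⟨e⟩ := h
  exact ⟨(groupCohomology.comapTrivialIso ψ hψ
    (Representation.equivOfAsModule e) A k).toLinearEquiv.toAddEquiv⟩
end

section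
/- Let ψ : Γ → G be a surjective group homomorphism and let P₁, P₂ ≤ G be ℤ-equivalent subgroups. Then the preimages Γ₁ = ψ⁻¹(P₁) and Γ₂ = ψ⁻¹(P₂) are ℤ-equivalent subgroups of Γ, i.e. ℤ[Γ/Γ₁] and ℤ[Γ/Γ₂] are isomorphic as ℤ[Γ]-modules. -/
open Representation

/-- Representations are equivalent if and only if the associated modules over the monoid algebra
are isomorphic. -/
theorem Representation.nonempty_linearEquiv_asModule_iff {k G V W : Type*} [CommSemiring k]
    [Monoid G] [AddCommMonoid V] [Module k V] [AddCommMonoid W] [Module k W]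
    {ρ : Representation k G V} {σ : Representation k G W} :
    Nonempty (ρ.asModule ≃ₗ[MonoidAlgebra k G] σ.asModule) ↔ Nonempty (ρ.Equiv σ) := by
  constructor
  · rintro ⟨e⟩
    exact ⟨IntertwiningMap.ofBijective
      ((IntertwiningMap.equivLinearMapAsModule ρ σ).symm e.toLinearMap) e.bijective⟩
  · rintro ⟨e⟩
    exact ⟨.ofBijective (IntertwiningMap.equivLinearMapAsModule ρ σ e.toIntertwiningMap)
      e.toLinearEquiv.bijective⟩

/-- An equivalence of representations of `G` restricts along a homomorphism `Γ →* G`. -/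
def Representation.Equiv.compMonoidHom {k Γ G V W : Type*} [CommSemiring k] [Monoid Γ] [Monoid G]
    [AddCommMonoid V] [Module k V] [AddCommMonoid W] [Module k W]
    {ρ : Representation k G V} {σ : Representation k G W} (e : ρ.Equiv σ) (ψ : Γ →* G) :
    Representation.Equiv (ρ.comp ψ : Representation k Γ V) (σ.comp ψ : Representation k Γ W) :=
  .mk e.toLinearEquiv fun γ => e.isIntertwining' (ψ γ)

/-- For `ψ : Γ →* G` surjective, `ψ` induces a bijection `Γ ⧸ ψ⁻¹(P) ≃ G ⧸ P`. -/
noncomputable def Subgroup.quotientComapEquiv {Γ G : Type*} [Group Γ] [Group G] (ψ : Γ →* G)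
    (hψ : Function.Surjective ψ) (P : Subgroup G) : Γ ⧸ P.comap ψ ≃ G ⧸ P :=
  .ofBijective (Quotient.map' ψ fun a b h => by
      simpa [QuotientGroup.leftRel_apply] using h) <| by
    constructor
    · rintro ⟨a⟩ ⟨b⟩ h
      have h' : (ψ a : G ⧸ P) = ψ b := h
      exact QuotientGroup.eq.2 (by simpa [QuotientGroup.eq] using h')
    · rintro ⟨g⟩
      obtain ⟨γ, rfl⟩ := hψ g
      exact ⟨(γ : Γ ⧸ P.comap ψ), rfl⟩

theorem Subgroup.quotientComapEquiv_smul {Γ G : Type*} [Group Γ] [Group G] (ψ : Γ →* G)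
    (hψ : Function.Surjective ψ) (P : Subgroup G) (γ : Γ) (x : Γ ⧸ P.comap ψ) :
    P.quotientComapEquiv ψ hψ (γ • x) = ψ γ • P.quotientComapEquiv ψ hψ x := by
  obtain ⟨a, rfl⟩ := QuotientGroup.mk_surjective x
  exact congrArg (QuotientGroup.mk (s := P)) (map_mul ψ γ a)

/-- For `ψ : Γ →* G` surjective, the permutation representation of `Γ` on `k[Γ ⧸ ψ⁻¹(P)]` is the
restriction along `ψ` of the permutation representation of `G` on `k[G ⧸ P]`. -/
noncomputable def Representation.ofMulActionQuotientComapEquiv (k : Type*) [CommSemiring k]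
    {Γ G : Type*} [Group Γ] [Group G] (ψ : Γ →* G) (hψ : Function.Surjective ψ)
    (P : Subgroup G) :
    Representation.Equiv (ofMulAction k Γ (Γ ⧸ P.comap ψ))
      ((ofMulAction k G (G ⧸ P)).comp ψ : Representation k Γ _) :=
  .mk (MonoidAlgebra.mapDomainLinearEquiv k k (P.quotientComapEquiv ψ hψ)) fun γ => by
    ext x
    simp [Subgroup.quotientComapEquiv_smul]

/-- If `ψ : Γ → G` is a surjective group homomorphism and `P₁, P₂ ≤ G` are `ℤ`-equivalent
subgroups, then the preimages `Γ₁ = ψ⁻¹(P₁)` and `Γ₂ = ψ⁻¹(P₂)` are `ℤ`-equivalent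
subgroups of `Γ`, i.e. `ℤ[Γ/Γ₁] ≅ ℤ[Γ/Γ₂]` as `ℤ[Γ]`-modules. -/
theorem isZEquiv_comap {Γ G : Type} [Group Γ] [Group G] (ψ : Γ →* G)
    (hψ : Function.Surjective ψ) {P₁ P₂ : Subgroup G} (h : Subgroup.IsZEquiv P₁ P₂) :
    Subgroup.IsZEquiv (P₁.comap ψ) (P₂.comap ψ) := by
  obtain ⟨e⟩ := Representation.nonempty_linearEquiv_asModule_iff.1 h
  exact Representation.nonempty_linearEquiv_asModule_iff.2
    ⟨((ofMulActionQuotientComapEquiv ℤ ψ hψ P₁).trans (e.compMonoidHom ψ)).trans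
      (ofMulActionQuotientComapEquiv ℤ ψ hψ P₂).symm⟩
end

section
/- Let G be a group and let H, K ≤ G be ℤ-equivalent subgroups of finite index. For a natural number m and a function z : {1,…,m} → {1,2}, let P_z ≤ G^m denote the direct product subgroup ∏_{i=1}^m P_{z(i)}, where P₁ = H and P₂ = K. Then for any z, z' : {1,…,m} → {1,2}, the subgroups P_z and P_{z'} are ℤ-equivalent in G^m. -/
open scoped TensorProduct

/-- Intertwining equivalences of representations give isomorphisms of group ring modules. -/
theorem Representation.Equiv.nonempty_asModule_linearEquiv {k G V W : Type*} [CommRing k] [Group G]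
    [AddCommGroup V] [Module k V] [AddCommGroup W] [Module k W]
    {ρ : Representation k G V} {σ : Representation k G W} (e : ρ.Equiv σ) :
    Nonempty (ρ.asModule ≃ₗ[MonoidAlgebra k G] σ.asModule) :=
  ⟨LinearEquiv.ofBijective
    (Representation.IntertwiningMap.equivLinearMapAsModule ρ σ e.toIntertwiningMap)
    e.toLinearEquiv.bijective⟩

/-- Isomorphisms of group ring modules give intertwining equivalences of representations. -/
theorem Representation.nonempty_equiv_of_asModule_linearEquiv {k G V W : Type*} [CommRing k]
    [Group G] [AddCommGroup V] [Module k V] [AddCommGroup W] [Module k W]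
    {ρ : Representation k G V} {σ : Representation k G W}
    (e : ρ.asModule ≃ₗ[MonoidAlgebra k G] σ.asModule) : Nonempty (ρ.Equiv σ) :=
  let f := (Representation.IntertwiningMap.equivLinearMapAsModule ρ σ).symm e.toLinearMap
  ⟨.mk (LinearEquiv.ofBijective f.toLinearMap e.bijective) f.isIntertwining'⟩

namespace Subgroup

theorem isZEquiv_iff_nonempty_equiv {G : Type} [Group G] {P Q : Subgroup G} :
    P.IsZEquiv Q ↔ Nonempty ((Representation.ofMulAction ℤ G (G ⧸ P)).Equiv
      (Representation.ofMulAction ℤ G (G ⧸ Q))) :=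
  ⟨fun ⟨e⟩ => Representation.nonempty_equiv_of_asModule_linearEquiv e,
    fun ⟨e⟩ => e.nonempty_asModule_linearEquiv⟩

theorem IsZEquiv.refl {G : Type} [Group G] (P : Subgroup G) : P.IsZEquiv P :=
  ⟨LinearEquiv.refl _ _⟩

theorem IsZEquiv.symm {G : Type} [Group G] {P Q : Subgroup G} (h : P.IsZEquiv Q) :
    Q.IsZEquiv P :=
  h.map LinearEquiv.symm

variable {ι : Type} {G : ι → Type} [∀ i, Group (G i)]

/-- The coset space of a product of subgroups is the product of the coset spaces. -/
noncomputable def quotientPiEquiv (P : ∀ i, Subgroup (G i)) :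
    ((∀ i, G i) ⧸ Subgroup.pi Set.univ P) ≃ ∀ i, G i ⧸ P i :=
  (Quotient.congrRight fun x y => by rw [QuotientGroup.leftRel_pi]).trans
    (Setoid.piQuotientEquiv _).symm

theorem quotientPiEquiv_smul (P : ∀ i, Subgroup (G i)) (g : ∀ i, G i)
    (x : (∀ i, G i) ⧸ Subgroup.pi Set.univ P) :
    quotientPiEquiv P (g • x) = fun i => g i • quotientPiEquiv P x i := by
  induction x using Quotient.inductionOn'
  rfl

variable [Fintype ι] [DecidableEq ι]

open scoped Classical in
/-- The permutation module of a product of subgroups is the tensor product of the permutation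
modules of the factors. -/
noncomputable def piTensorPermEquiv (P : ∀ i, Subgroup (G i)) :
    (⨂[ℤ] i, MonoidAlgebra ℤ (G i ⧸ P i)) ≃ₗ[ℤ]
      MonoidAlgebra ℤ ((∀ i, G i) ⧸ Subgroup.pi Set.univ P) :=
  PiTensorProduct.congr (fun _ => MonoidAlgebra.coeffLinearEquiv ℤ) ≪≫ₗ
    PiTensorProduct.ofFinsuppEquiv' ≪≫ₗ (MonoidAlgebra.coeffLinearEquiv ℤ).symm ≪≫ₗ
    MonoidAlgebra.mapDomainLinearEquiv ℤ ℤ (quotientPiEquiv P).symm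

theorem coeff_piTensorPermEquiv_tprod (P : ∀ i, Subgroup (G i))
    (x : ∀ i, MonoidAlgebra ℤ (G i ⧸ P i)) (q : (∀ i, G i) ⧸ Subgroup.pi Set.univ P) :
    (piTensorPermEquiv P (⨂ₜ[ℤ] i, x i)).coeff q =
      ∏ i, (x i).coeff (quotientPiEquiv P q i) := by
  simp [piTensorPermEquiv]

theorem piTensorPermEquiv_comp_map (P : ∀ i, Subgroup (G i)) (g : ∀ i, G i) :
    (piTensorPermEquiv P).toLinearMap ∘ₗ
        PiTensorProduct.map (fun i => Representation.ofMulAction ℤ (G i) (G i ⧸ P i) (g i)) =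
      Representation.ofMulAction ℤ (∀ i, G i) _ g ∘ₗ (piTensorPermEquiv P).toLinearMap := by
  ext x q
  simp [coeff_piTensorPermEquiv_tprod, Representation.coeff_ofMulAction, quotientPiEquiv_smul]

/-- `ℤ`-equivalence is compatible with finite direct products. -/
theorem IsZEquiv.pi {P Q : ∀ i, Subgroup (G i)} (h : ∀ i, (P i).IsZEquiv (Q i)) :
    (Subgroup.pi Set.univ P).IsZEquiv (Subgroup.pi Set.univ Q) := by
  have e := fun i => (isZEquiv_iff_nonempty_equiv.1 (h i)).some
  refine isZEquiv_iff_nonempty_equiv.2 ⟨.mk ((piTensorPermEquiv P).symm ≪≫ₗ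
    PiTensorProduct.congr (fun i => (e i).toLinearEquiv) ≪≫ₗ piTensorPermEquiv Q) fun g => ?_⟩
  have hP := piTensorPermEquiv_comp_map P g
  have hQ := piTensorPermEquiv_comp_map Q g
  have he : (PiTensorProduct.congr fun i => (e i).toLinearEquiv).toLinearMap ∘ₗ
      PiTensorProduct.map (fun i => Representation.ofMulAction ℤ (G i) (G i ⧸ P i) (g i)) =
      PiTensorProduct.map (fun i => Representation.ofMulAction ℤ (G i) (G i ⧸ Q i) (g i)) ∘ₗ
        (PiTensorProduct.congr fun i => (e i).toLinearEquiv).toLinearMap := by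
    refine PiTensorProduct.ext (MultilinearMap.ext fun x => ?_)
    simp [Representation.Equiv.toLinearEquiv_apply, Representation.IntertwiningMap.isIntertwining]
  refine LinearMap.ext fun x => ?_
  obtain ⟨t, rfl⟩ := (piTensorPermEquiv P).surjective x
  have hP' := LinearMap.congr_fun hP t
  have he' := LinearMap.congr_fun he t
  have hQ' := LinearMap.congr_fun hQ (PiTensorProduct.congr (fun i => (e i).toLinearEquiv) t)
  simp only [LinearMap.comp_apply, LinearEquiv.coe_coe, LinearEquiv.trans_apply,
    LinearEquiv.symm_apply_apply] at hP' he' hQ' ⊢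
  rw [← hP', LinearEquiv.symm_apply_apply, he', hQ']

end Subgroup

/-- Let `H, K ≤ G` be `ℤ`-equivalent subgroups of finite index.  For `z : Fin m → Fin 2`
let `P_z ≤ G^m` be the direct product `∏ᵢ P_{z i}` where `P 0 = H` and `P 1 = K`.  Then for
any `z, z'` the subgroups `P_z` and `P_{z'}` are `ℤ`-equivalent in `G^m`. -/
theorem prod_isZEquiv {G : Type} [Group G] (H K : Subgroup G)
    [H.FiniteIndex] [K.FiniteIndex] (hHK : Subgroup.IsZEquiv H K)
    (m : ℕ) (z z' : Fin m → Fin 2) :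
    Subgroup.IsZEquiv (G := Fin m → G)
      (Subgroup.pi Set.univ fun i => ![H, K] (z i))
      (Subgroup.pi Set.univ fun i => ![H, K] (z' i)) := by
  refine Subgroup.IsZEquiv.pi fun i => ?_
  have key : ∀ a b : Fin 2, Subgroup.IsZEquiv (![H, K] a) (![H, K] b) := by
    simpa [Fin.forall_fin_two] using
      ⟨⟨Subgroup.IsZEquiv.refl H, hHK⟩, hHK.symm, Subgroup.IsZEquiv.refl K⟩
  exact key (z i) (z' i)
end

section
/- Let G be a group and let H, K ≤ G be subgroups that are not conjugate in G. For a natural number m and a function z : {1,…,m} → {1,2}, let P_z ≤ G^m denote the direct product subgroup ∏_{i=1}^m P_{z(i)}, where P₁ = H and P₂ = K. Then for any distinct z, z' : {1,…,m} → {1,2}, the subgroups P_z and P_{z'} are not conjugate in G^m. -/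
/-- Subgroups `A, B ≤ G` are conjugate if there is `g ∈ G` with `g⁻¹ A g = B`. -/
def Subgroup.IsConjugate {G : Type} [Group G] (A B : Subgroup G) : Prop :=
  ∃ g : G, (fun a => g⁻¹ * a * g) '' (A : Set G) = (B : Set G)

namespace Subgroup

theorem isConjugate_iff_exists_forall_mem_iff {G : Type} [Group G] {A B : Subgroup G} :
    A.IsConjugate B ↔ ∃ g : G, ∀ x, x ∈ A ↔ g⁻¹ * x * g ∈ B := by
  refine exists_congr fun g => ⟨fun h x => ?_, fun h => Set.ext fun y => ⟨?_, fun hy => ?_⟩⟩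
  · have hinj : Function.Injective fun a : G => g⁻¹ * a * g := fun a b hab => by simpa using hab
    rw [← SetLike.mem_coe (p := B), ← h]
    exact (hinj.mem_set_image (s := (A : Set G)) (a := x)).symm
  · rintro ⟨x, hx, rfl⟩
    exact (h x).1 hx
  · exact ⟨g * y * g⁻¹, (h _).2 (by simpa [mul_assoc] using hy), by simp [mul_assoc]⟩

theorem IsConjugate.symm {G : Type} [Group G] {A B : Subgroup G} (h : A.IsConjugate B) :
    B.IsConjugate A := by
  rw [isConjugate_iff_exists_forall_mem_iff] at h ⊢
  obtain ⟨g, hg⟩ := h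
  exact ⟨g⁻¹, fun x => by rw [hg]; simp [mul_assoc]⟩

/-- Conjugate direct products have conjugate factors. -/
theorem IsConjugate.of_pi {G ι : Type} [Group G] {A B : ι → Subgroup G}
    (h : IsConjugate (G := ι → G) (pi Set.univ A) (pi Set.univ B)) (i : ι) :
    (A i).IsConjugate (B i) := by
  classical
  rw [isConjugate_iff_exists_forall_mem_iff] at h ⊢
  obtain ⟨g, hg⟩ := h
  refine ⟨g i, fun x => ?_⟩
  have hconj : g⁻¹ * Pi.mulSingle i x * g = Pi.mulSingle i ((g i)⁻¹ * x * g i) := by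
    ext j
    obtain rfl | hj := eq_or_ne j i
    · simp
    · simp [hj]
  simpa [hconj, mulSingle_mem_pi] using hg (Pi.mulSingle i x)

end Subgroup

/-- Let `H, K ≤ G` be subgroups which are not conjugate in `G`.  For `z : Fin m → Fin 2`
let `P_z ≤ G^m` be the direct product `∏ᵢ P_{z i}` where `P 0 = H` and `P 1 = K`.  Then for
any distinct `z, z'` the subgroups `P_z` and `P_{z'}` are not conjugate in `G^m`. -/
theorem prod_not_conjugate {G : Type} [Group G] (H K : Subgroup G)
    (hHK : ¬ H.IsConjugate K) (m : ℕ) (z z' : Fin m → Fin 2) (hzz' : z ≠ z') :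
    ¬ Subgroup.IsConjugate (G := Fin m → G)
      (Subgroup.pi Set.univ fun i => ![H, K] (z i))
      (Subgroup.pi Set.univ fun i => ![H, K] (z' i)) := by
  intro h
  obtain ⟨i, hi⟩ := Function.ne_iff.1 hzz'
  have hconj := h.of_pi i
  generalize z i = a, z' i = b at hi hconj
  fin_cases a <;> fin_cases b
  · exact hi rfl
  · exact hHK hconj
  · exact hHK hconj.symm
  · exact hi rfl
end

section
/- Let C be a preadditive category that is ℚ-linear, let V be an object of C, let G be a finite group, and let ρ : ℚ[G] → End_C(V) be a homomorphism of ℚ-algebras. Let P₁, P₂ ≤ G be subgroups with ℚ[G/P₁] ≅ ℚ[G/P₂] as ℚ[G]-modules, and set eᵢ = ρ(e_{Pᵢ}) ∈ End_C(V), which are idempotent endomorphisms. Suppose for i = 1, 2 the idempotent eᵢ splits: there exist an object Vᵢ and morphisms rᵢ : V → Vᵢ, sᵢ : Vᵢ → V with rᵢ ∘ sᵢ = id_{Vᵢ} and sᵢ ∘ rᵢ = eᵢ. Then V₁ and V₂ are isomorphic objects of C. -/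
open CategoryTheory

open scoped Classical in
/-- The idempotent `e_P = (1/|P|) ∑_{g ∈ P} g` of the rational group algebra `ℚ[G]`. -/
noncomputable def Subgroup.idempotent {G : Type} [Group G] [Fintype G] (P : Subgroup G) :
    MonoidAlgebra ℚ G :=
  (Nat.card P : ℚ)⁻¹ • ∑ g : ↥P, MonoidAlgebra.single (g : G) (1 : ℚ)

namespace Subgroup

variable {G : Type} [Group G] (P : Subgroup G)

/-- The trivial coset, as an element of the permutation module `ℚ[G/P]`. -/
noncomputable def trivialCoset : (Representation.ofMulAction ℚ G (G ⧸ P)).asModule :=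
  (Representation.asModuleEquiv _).symm (MonoidAlgebra.single ((1 : G) : G ⧸ P) 1)

theorem asModuleEquiv_single_smul_trivialCoset (g : G) (t : ℚ) :
    (Representation.ofMulAction ℚ G (G ⧸ P)).asModuleEquiv
      (MonoidAlgebra.single g t • P.trivialCoset) = MonoidAlgebra.single (g : G ⧸ P) t := by
  rw [Representation.asModuleEquiv_map_smul, trivialCoset, LinearEquiv.apply_symm_apply,
    Representation.asAlgebraHom_single, LinearMap.smul_apply, Representation.ofMulAction_single,
    MulAction.Quotient.smul_coe, smul_eq_mul, mul_one, MonoidAlgebra.smul_single, smul_eq_mul,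
    mul_one]

/-- The trivial coset generates the permutation module. -/
theorem exists_smul_trivialCoset_eq (y : (Representation.ofMulAction ℚ G (G ⧸ P)).asModule) :
    ∃ a : MonoidAlgebra ℚ G, a • P.trivialCoset = y := by
  obtain ⟨y, rfl⟩ := (Representation.asModuleEquiv _).symm.surjective y
  induction y using MonoidAlgebra.induction_linear with
  | zero => exact ⟨0, by simp⟩
  | add y z hy hz =>
    obtain ⟨a, ha⟩ := hy
    obtain ⟨b, hb⟩ := hz
    exact ⟨a + b, by rw [add_smul, ha, hb, map_add]⟩
  | single m t =>
    obtain ⟨g, rfl⟩ := QuotientGroup.mk_surjective m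
    exact ⟨MonoidAlgebra.single g t, by
      rw [LinearEquiv.eq_symm_apply, asModuleEquiv_single_smul_trivialCoset]⟩

variable [Fintype G]

theorem single_mul_idempotent {p : G} (hp : p ∈ P) :
    MonoidAlgebra.single p (1 : ℚ) * P.idempotent = P.idempotent := by
  classical
  unfold idempotent
  rw [mul_smul_comm, Finset.mul_sum]
  congr 1
  refine Fintype.sum_equiv (Equiv.mulLeft (⟨p, hp⟩ : P)) _ _ fun g => ?_
  simp [MonoidAlgebra.single_mul_single]

/-- If each `p ∈ P` fixes `x`, then so does the idempotent `e_P`. -/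
theorem idempotent_smul_of_fixed {M : Type*} [AddCommGroup M] [Module (MonoidAlgebra ℚ G) M]
    {x : M} (hx : ∀ p ∈ P, MonoidAlgebra.single p (1 : ℚ) • x = x) : P.idempotent • x = x := by
  classical
  have hc : (Nat.card P : ℚ) ≠ 0 := Nat.cast_ne_zero.mpr Nat.card_pos.ne'
  have hsum : (∑ g : ↥P, MonoidAlgebra.single (g : G) (1 : ℚ)) • x =
      (Nat.card P : MonoidAlgebra ℚ G) • x := by
    rw [Finset.sum_smul, Finset.sum_congr rfl fun (g : ↥P) _ => hx g g.2]
    simp [Nat.card_eq_fintype_card, Nat.cast_smul_eq_nsmul]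
  rw [idempotent, Algebra.smul_def, mul_smul, hsum, smul_smul,
    ← map_natCast (algebraMap ℚ (MonoidAlgebra ℚ G)), ← map_mul, inv_mul_cancel₀ hc, map_one,
    one_smul]

theorem idempotent_mul_self : P.idempotent * P.idempotent = P.idempotent :=
  P.idempotent_smul_of_fixed fun _ hp => P.single_mul_idempotent hp

theorem idempotent_smul_trivialCoset : P.idempotent • P.trivialCoset = P.trivialCoset := by
  refine P.idempotent_smul_of_fixed fun p hp => ?_
  apply (Representation.asModuleEquiv _).injective
  rw [asModuleEquiv_single_smul_trivialCoset, trivialCoset, LinearEquiv.apply_symm_apply,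
    QuotientGroup.eq.mpr (by simpa using hp : p⁻¹ * 1 ∈ P)]

/-- The linear map `ℚ[G/P] → ℚ[G]` sending the coset `gP` to `g * e_P`. -/
noncomputable def permutationModuleToGroupAlgebra :
    MonoidAlgebra ℚ (G ⧸ P) →ₗ[ℚ] MonoidAlgebra ℚ G :=
  Finsupp.linearCombination ℚ (fun x : G ⧸ P =>
    Quotient.liftOn' x (fun g => MonoidAlgebra.single g (1 : ℚ) * P.idempotent) fun a b hab => by
      have h := P.single_mul_idempotent (QuotientGroup.leftRel_apply.mp hab)
      rw [← h, ← mul_assoc, MonoidAlgebra.single_mul_single, h]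
      simp) ∘ₗ (MonoidAlgebra.coeffLinearEquiv ℚ).toLinearMap

theorem permutationModuleToGroupAlgebra_single (g : G) (t : ℚ) :
    P.permutationModuleToGroupAlgebra (MonoidAlgebra.single (g : G ⧸ P) t) =
      MonoidAlgebra.single g t * P.idempotent := by
  have h : P.permutationModuleToGroupAlgebra (MonoidAlgebra.single (g : G ⧸ P) t) =
      t • (MonoidAlgebra.single g (1 : ℚ) * P.idempotent) := by
    simp [permutationModuleToGroupAlgebra]
  rw [h, ← smul_mul_assoc, MonoidAlgebra.smul_single, smul_eq_mul, mul_one]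

theorem permutationModuleToGroupAlgebra_smul_trivialCoset (a : MonoidAlgebra ℚ G) :
    P.permutationModuleToGroupAlgebra ((Representation.ofMulAction ℚ G (G ⧸ P)).asModuleEquiv
      (a • P.trivialCoset)) = a * P.idempotent := by
  induction a using MonoidAlgebra.induction_linear with
  | zero => simp
  | add a b ha hb => rw [add_smul, map_add, map_add, ha, hb, add_mul]
  | single g t =>
    rw [asModuleEquiv_single_smul_trivialCoset, permutationModuleToGroupAlgebra_single]

theorem mul_idempotent_of_smul_trivialCoset_eq {a : MonoidAlgebra ℚ G}
    (h : a • P.trivialCoset = P.trivialCoset) : a * P.idempotent = P.idempotent := by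
  rw [← permutationModuleToGroupAlgebra_smul_trivialCoset, h,
    ← one_smul (MonoidAlgebra ℚ G) P.trivialCoset,
    permutationModuleToGroupAlgebra_smul_trivialCoset, one_mul]

variable {P} {Q : Subgroup G}

/-- A homomorphism of permutation modules is given by right multiplication by an element
of `e_P ℚ[G] e_Q`. -/
theorem exists_smul_trivialCoset_eq_map
    (f : (Representation.ofMulAction ℚ G (G ⧸ P)).asModule →ₗ[MonoidAlgebra ℚ G]
      (Representation.ofMulAction ℚ G (G ⧸ Q)).asModule) :
    ∃ a : MonoidAlgebra ℚ G, P.idempotent * a = a ∧ a * Q.idempotent = a ∧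
      a • Q.trivialCoset = f P.trivialCoset := by
  obtain ⟨a, ha⟩ := Q.exists_smul_trivialCoset_eq (f P.trivialCoset)
  refine ⟨P.idempotent * a * Q.idempotent, ?_, ?_, ?_⟩
  · rw [← mul_assoc, ← mul_assoc, idempotent_mul_self]
  · rw [mul_assoc, idempotent_mul_self]
  · rw [mul_smul, idempotent_smul_trivialCoset, mul_smul, ha, ← map_smul,
      idempotent_smul_trivialCoset]

/-- The product of elements representing mutually inverse homomorphisms is `e_P`. -/
theorem mul_eq_idempotent_of_leftInverse
    {f : (Representation.ofMulAction ℚ G (G ⧸ P)).asModule →ₗ[MonoidAlgebra ℚ G]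
      (Representation.ofMulAction ℚ G (G ⧸ Q)).asModule}
    {g : (Representation.ofMulAction ℚ G (G ⧸ Q)).asModule →ₗ[MonoidAlgebra ℚ G]
      (Representation.ofMulAction ℚ G (G ⧸ P)).asModule}
    (hgf : Function.LeftInverse g f) {a b : MonoidAlgebra ℚ G}
    (ha : a • Q.trivialCoset = f P.trivialCoset) (hb : b • P.trivialCoset = g Q.trivialCoset)
    (hbP : b * P.idempotent = b) : a * b = P.idempotent := by
  rw [← hbP, ← mul_assoc]
  apply mul_idempotent_of_smul_trivialCoset_eq
  rw [mul_smul, hb, ← map_smul, ha, hgf]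

end Subgroup

/-- Let `C` be a `ℚ`-linear preadditive category, `V` an object of `C`, `G` a finite group
and `ρ : ℚ[G] → End_C(V)` a homomorphism of `ℚ`-algebras.  Let `P₁, P₂ ≤ G` be subgroups
with `ℚ[G/P₁] ≅ ℚ[G/P₂]` as `ℚ[G]`-modules, and suppose the idempotents `eᵢ = ρ(e_{Pᵢ})`
split: there are objects `Vᵢ` and morphisms `rᵢ : V → Vᵢ`, `sᵢ : Vᵢ → V` with
`rᵢ ∘ sᵢ = id` and `sᵢ ∘ rᵢ = eᵢ`.  Then `V₁ ≅ V₂`. -/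
theorem iso_of_split_idempotents_of_permutationModule_iso
    {C : Type*} [Category C] [Preadditive C] [Linear ℚ C] (V : C)
    {G : Type} [Group G] [Fintype G]
    (ρ : MonoidAlgebra ℚ G →ₐ[ℚ] CategoryTheory.End V) (P₁ P₂ : Subgroup G)
    (h : Nonempty ((Representation.ofMulAction ℚ G (G ⧸ P₁)).asModule ≃ₗ[MonoidAlgebra ℚ G]
      (Representation.ofMulAction ℚ G (G ⧸ P₂)).asModule))
    (V₁ V₂ : C) (r₁ : V ⟶ V₁) (s₁ : V₁ ⟶ V) (r₂ : V ⟶ V₂) (s₂ : V₂ ⟶ V)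
    (h₁ : s₁ ≫ r₁ = 𝟙 V₁) (e₁ : r₁ ≫ s₁ = ρ P₁.idempotent)
    (h₂ : s₂ ≫ r₂ = 𝟙 V₂) (e₂ : r₂ ≫ s₂ = ρ P₂.idempotent) :
    Nonempty (V₁ ≅ V₂) := by
  obtain ⟨f⟩ := h
  obtain ⟨a, ha₁, ha₂, ha⟩ := Subgroup.exists_smul_trivialCoset_eq_map f.toLinearMap
  obtain ⟨b, hb₂, hb₁, hb⟩ := Subgroup.exists_smul_trivialCoset_eq_map f.symm.toLinearMap
  have hab : a * b = P₁.idempotent :=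
    Subgroup.mul_eq_idempotent_of_leftInverse f.symm_apply_apply ha hb hb₁
  have hba : b * a = P₂.idempotent :=
    Subgroup.mul_eq_idempotent_of_leftInverse f.apply_symm_apply hb ha ha₂
  have hρ (x y : MonoidAlgebra ℚ G) : ρ y ≫ ρ x = ρ (x * y) := (map_mul ρ x y).symm
  have comp {X Y Z : C} (s : X ⟶ V) (r : V ⟶ Y) (s' : Y ⟶ V) (r' : V ⟶ Z)
      (x y z : MonoidAlgebra ℚ G) (hz : r ≫ s' = ρ z) :
      (s ≫ ρ x ≫ r) ≫ s' ≫ ρ y ≫ r' = s ≫ ρ (y * (z * x)) ≫ r' := by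
    rw [← hρ, ← hρ, ← hz]
    simp only [Category.assoc]
  refine ⟨⟨s₁ ≫ ρ b ≫ r₂, s₂ ≫ ρ a ≫ r₁, ?_, ?_⟩⟩
  · rw [comp _ _ _ _ _ _ _ e₂, hb₂, hab, ← e₁, Category.assoc, h₁, Category.comp_id, h₁]
  · rw [comp _ _ _ _ _ _ _ e₁, ha₁, hba, ← e₂, Category.assoc, h₂, Category.comp_id, h₂]
end
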